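/- arXiv:1712.05472 — 2 statements merged into one kernel-verified Lean document; each statement's English description precedes it below -/
import Mathlib

section
/- Let n ≥ 1, let w : ℝ × (Fin n → ℝ) → ℝ be smooth (C^∞) with w(t,x) > 0 for all (t,x), and suppose w solves the heat equation ∂_t w(t,x) = ∑_{j} ∂_j ∂_j w(t,x) for all (t,x), where ∂_j denotes the partial derivative in the j-th spatial coordinate. For each i define u_i(t,x) := -2 · ∂_i w(t,x) / w(t,x). Then for every i and all (t,x): ∂_t u_i(t,x) = ∑_j ∂_j ∂_j u_i(t,x) - ∑_j u_j(t,x) · ∂_j u_i(t,x); that is, the gradient field u = -2 ∇ log w solves the viscous Burgers equation u_t = Δu - ⟨u, ∇⟩u componentwise. -/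
/-- Partial derivative of `f : (Fin n → ℝ) → ℝ` in the `j`-th coordinate direction. -/
noncomputable def pderivCoord {n : ℕ} (j : Fin n) (f : (Fin n → ℝ) → ℝ)
    (x : Fin n → ℝ) : ℝ :=
  fderiv ℝ f x (Pi.single j 1)

section DirDeriv

variable {E : Type*} [NormedAddCommGroup E] [NormedSpace ℝ E]

/-- The derivative of `f` in the direction `v`, as a function of the base point. -/
noncomputable def dirDeriv (v : E) (f : E → ℝ) (p : E) : ℝ :=
  fderiv ℝ f p v

theorem ContDiff.dirDeriv {f : E → ℝ} (hf : ContDiff ℝ (⊤ : ℕ∞) f) (v : E) :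
    ContDiff ℝ (⊤ : ℕ∞) (dirDeriv v f) :=
  (hf.fderiv_right (m := (⊤ : ℕ∞)) le_rfl).clm_apply contDiff_const

theorem ContDiff.differentiable_of_top {f : E → ℝ} (hf : ContDiff ℝ (⊤ : ℕ∞) f) :
    Differentiable ℝ f :=
  hf.differentiable (by simp)

theorem dirDeriv_comm {f : E → ℝ} (hf : ContDiff ℝ (⊤ : ℕ∞) f) (v v' : E) :
    dirDeriv v (dirDeriv v' f) = dirDeriv v' (dirDeriv v f) := by
  have hf' : Differentiable ℝ (fderiv ℝ f) :=
    (hf.fderiv_right (m := (⊤ : ℕ∞)) le_rfl).differentiable (by simp)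
  have key (a b p : E) : dirDeriv a (dirDeriv b f) p = fderiv ℝ (fderiv ℝ f) p a b := by
    change fderiv ℝ (fun q => fderiv ℝ f q b) p a = _
    rw [fderiv_clm_apply (hf' p) (differentiableAt_const b)]
    simp
  have hf_top : (2 : WithTop ℕ∞) ≤ ((⊤ : ℕ∞) : WithTop ℕ∞) :=
    WithTop.coe_le_coe.2 (le_top : (2 : ℕ∞) ≤ ⊤)
  funext p
  rw [key, key]
  exact (hf.contDiffAt.isSymmSndFDerivAt (by simpa using hf_top)) v v'

theorem dirDeriv_const_mul {f : E → ℝ} (hf : ContDiff ℝ (⊤ : ℕ∞) f) (c : ℝ) (v : E) :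
    dirDeriv v (fun q => c * f q) = fun q => c * dirDeriv v f q := by
  funext p
  simp [dirDeriv, fderiv_const_mul (hf.differentiable_of_top p)]

/-- If `φ` solves `∂_τ φ = ∑ⱼ (∂ⱼ∂ⱼ φ + (∂ⱼ φ)²)`, then every `∂ᵢ φ` solves the differentiated
equation. -/
theorem dirDeriv_dirDeriv_of_potential {ι : Type*} [Fintype ι] {φ : E → ℝ}
    (hφ : ContDiff ℝ (⊤ : ℕ∞) φ) (s : E) (e : ι → E)
    (h : ∀ p, dirDeriv s φ p =
      ∑ j, (dirDeriv (e j) (dirDeriv (e j) φ) p + dirDeriv (e j) φ p ^ 2)) (v p : E) :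
    dirDeriv s (dirDeriv v φ) p =
      ∑ j, (dirDeriv (e j) (dirDeriv (e j) (dirDeriv v φ)) p
        + 2 * dirDeriv (e j) φ p * dirDeriv (e j) (dirDeriv v φ) p) := by
  have hd (j : ι) := (hφ.dirDeriv (e j)).differentiable_of_top p
  have hdd (j : ι) := ((hφ.dirDeriv (e j)).dirDeriv (e j)).differentiable_of_top p
  rw [dirDeriv_comm hφ s v, funext h]
  conv_lhs => unfold dirDeriv
  change fderiv ℝ (fun q => ∑ j, (dirDeriv (e j) (dirDeriv (e j) φ) q
    + dirDeriv (e j) φ q ^ 2)) p v = _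
  rw [fderiv_fun_sum fun j _ => (hdd j).fun_add ((hd j).fun_pow 2), sum_apply]
  refine Finset.sum_congr rfl fun j _ => ?_
  rw [dirDeriv_comm hφ (e j) v, dirDeriv_comm (hφ.dirDeriv (e j)) (e j) v,
    fderiv_fun_add (hdd j) ((hd j).fun_pow 2), fderiv_fun_pow 2 (hd j)]
  simp [dirDeriv]

theorem dirDeriv_log {w : E → ℝ} (hw : ContDiff ℝ (⊤ : ℕ∞) w) (hpos : ∀ p, 0 < w p) (v : E) :
    dirDeriv v (fun q => Real.log (w q)) = fun q => dirDeriv v w q / w q := by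
  funext p
  simp [dirDeriv, fderiv.log (hw.differentiable_of_top p) (hpos p).ne', div_eq_inv_mul]

theorem dirDeriv_logDeriv {w : E → ℝ} (hw : ContDiff ℝ (⊤ : ℕ∞) w) (hpos : ∀ p, 0 < w p)
    (v p : E) :
    dirDeriv v (fun q => dirDeriv v w q / w q) p =
      dirDeriv v (dirDeriv v w) p / w p - (dirDeriv v w p / w p) ^ 2 := by
  have hg : DifferentiableAt ℝ (fun q => dirDeriv v w q / w q) p :=
    ((hw.dirDeriv v).div hw fun q => (hpos q).ne').differentiable_of_top p
  have hmul : (fun q => dirDeriv v w q / w q * w q) = dirDeriv v w :=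
    funext fun q => div_mul_cancel₀ _ (hpos q).ne'
  have hne := (hpos p).ne'
  have h : dirDeriv v (fun q => dirDeriv v w q / w q * w q) p =
      dirDeriv v w p / w p * dirDeriv v w p
        + w p * dirDeriv v (fun q => dirDeriv v w q / w q) p := by
    change fderiv ℝ _ p v = _ * fderiv ℝ w p v + _ * fderiv ℝ _ p v
    rw [fderiv_fun_mul hg (hw.differentiable_of_top p)]
    simp
  rw [hmul] at h
  rw [h]
  field_simp
  ring

end DirDeriv

theorem deriv_slice_eq_dirDeriv {F : Type*} [NormedAddCommGroup F] [NormedSpace ℝ F]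
    {f : ℝ × F → ℝ} (hf : Differentiable ℝ f) (t : ℝ) (x : F) :
    deriv (fun τ => f (τ, x)) t = dirDeriv (1, 0) f (t, x) :=
  ((hf (t, x)).hasFDerivAt.comp_hasDerivAt t
    ((hasDerivAt_id t).prodMk (hasDerivAt_const t x))).deriv

theorem pderivCoord_slice_eq_dirDeriv {n : ℕ} {f : ℝ × (Fin n → ℝ) → ℝ}
    (hf : Differentiable ℝ f) (j : Fin n) (t : ℝ) :
    pderivCoord j (fun y => f (t, y)) =
      fun x => dirDeriv ((0 : ℝ), Pi.single j (1 : ℝ)) f (t, x) := by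
  funext x
  have h := (hf (t, x)).hasFDerivAt.comp x (hasFDerivAt_prodMk_right (𝕜 := ℝ) t x)
  change fderiv ℝ (f ∘ fun y => (t, y)) x _ = _
  rw [h.fderiv]
  simp [dirDeriv]

/-- Cole-Hopf in `ℝⁿ`: if `w` is smooth, strictly positive and solves the heat equation
`∂_t w = ∑_j ∂_j ∂_j w`, then the gradient field `u = -2 ∇ log w`, i.e.
`u_i = -2 ∂_i w / w`, solves the viscous Burgers equation
`∂_t u_i = ∑_j ∂_j ∂_j u_i - ∑_j u_j ∂_j u_i` componentwise. -/
theorem cole_hopf_solves_burgers_rn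
    (n : ℕ) (hn : 1 ≤ n) (w : ℝ × (Fin n → ℝ) → ℝ)
    (hw : ContDiff ℝ (⊤ : ℕ∞) w)
    (hpos : ∀ p : ℝ × (Fin n → ℝ), 0 < w p)
    (hheat : ∀ (t : ℝ) (x : Fin n → ℝ),
      deriv (fun τ => w (τ, x)) t =
        ∑ j, pderivCoord j (pderivCoord j (fun y => w (t, y))) x)
    (u : Fin n → ℝ × (Fin n → ℝ) → ℝ)
    (hu : ∀ (i : Fin n) (t : ℝ) (x : Fin n → ℝ),
      u i (t, x) = -2 * pderivCoord i (fun y => w (t, y)) x / w (t, x)) :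
    ∀ (i : Fin n) (t : ℝ) (x : Fin n → ℝ),
      deriv (fun τ => u i (τ, x)) t =
        (∑ j, pderivCoord j (pderivCoord j (fun y => u i (t, y))) x)
          - ∑ j, u j (t, x) * pderivCoord j (fun y => u i (t, y)) x := by
  intro i t x
  let e : Fin n → ℝ × (Fin n → ℝ) := fun j => (0, Pi.single j 1)
  let φ : ℝ × (Fin n → ℝ) → ℝ := fun q => Real.log (w q)
  have hφ : ContDiff ℝ (⊤ : ℕ∞) φ := hw.log fun p => (hpos p).ne'
  have slice {f : ℝ × (Fin n → ℝ) → ℝ} (hf : ContDiff ℝ (⊤ : ℕ∞) f) (j : Fin n) (t : ℝ) :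
      pderivCoord j (fun y => f (t, y)) = fun y => dirDeriv (e j) f (t, y) :=
    pderivCoord_slice_eq_dirDeriv hf.differentiable_of_top j t
  have hpot (p : ℝ × (Fin n → ℝ)) : dirDeriv (1, 0) φ p =
      ∑ j, (dirDeriv (e j) (dirDeriv (e j) φ) p + dirDeriv (e j) φ p ^ 2) := by
    have hh := hheat p.1 p.2
    rw [deriv_slice_eq_dirDeriv hw.differentiable_of_top] at hh
    simp only [slice hw, slice (hw.dirDeriv _)] at hh
    simp only [φ, dirDeriv_log hw hpos, dirDeriv_logDeriv hw hpos, sub_add_cancel]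
    rw [← Finset.sum_div, hh]
  have hu' (j : Fin n) : u j = fun p => -2 * dirDeriv (e j) φ p := by
    funext ⟨t, x⟩
    rw [hu, slice hw, dirDeriv_log hw hpos, mul_div_assoc]
  have hd := hφ.dirDeriv (e i)
  have hu_smooth : ContDiff ℝ (⊤ : ℕ∞) (u i) := by
    rw [hu']
    exact contDiff_const.mul hd
  rw [deriv_slice_eq_dirDeriv hu_smooth.differentiable_of_top]
  simp only [slice hu_smooth, slice (hu_smooth.dirDeriv _)]
  simp only [hu', dirDeriv_const_mul hd, dirDeriv_const_mul (hd.dirDeriv _),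
    dirDeriv_dirDeriv_of_potential hφ (1, 0) e hpot, ← Finset.sum_sub_distrib, Finset.mul_sum]
  exact Finset.sum_congr rfl fun j _ => by ring
end

section
/- Let γ > 0 and let w, v : ℝ → ℝ be differentiable on [0,1] with derivatives w', v' such that w', v', (w')², (v')² are integrable on [0,1], and w(x) ≥ γ and v(x) ≥ γ for all x ∈ [0,1]. Then (∫_0^1 (w'(x)/w(x) - v'(x)/v(x))² dx)^{1/2} ≤ γ^{-1} · (∫_0^1 (w'(x) - v'(x))² dx)^{1/2} + γ^{-2} · (sup_{x ∈ [0,1]} |w(x) - v(x)|) · (∫_0^1 v'(x)² dx)^{1/2}. -/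
open MeasureTheory intervalIntegral

/-- Minkowski's inequality in `L²`, stated with integrals of squares. -/
theorem sqrt_integral_add_sq_le {α : Type*} [MeasurableSpace α] {μ : Measure α} {f g : α → ℝ}
    (hf : MemLp f 2 μ) (hg : MemLp g 2 μ) :
    Real.sqrt (∫ x, (f x + g x) ^ 2 ∂μ) ≤
      Real.sqrt (∫ x, f x ^ 2 ∂μ) + Real.sqrt (∫ x, g x ^ 2 ∂μ) := by
  have key : ∀ {h : α → ℝ}, MemLp h 2 μ →
      Real.sqrt (∫ x, h x ^ 2 ∂μ) = (eLpNorm h 2 μ).toReal := by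
    intro h hh
    rw [hh.eLpNorm_eq_integral_rpow_norm two_ne_zero ENNReal.ofNat_ne_top,
      ENNReal.toReal_ofReal (by positivity), Real.sqrt_eq_rpow]
    simp
  have hfg := key (hf.add hg)
  simp only [Pi.add_apply] at hfg
  rw [hfg, key hf, key hg, ← ENNReal.toReal_add hf.eLpNorm_ne_top hg.eLpNorm_ne_top]
  exact ENNReal.toReal_mono (ENNReal.add_ne_top.2 ⟨hf.eLpNorm_ne_top, hg.eLpNorm_ne_top⟩)
    (eLpNorm_add_le hf.1 hg.1 one_le_two)

/-- Pointwise comparison of quotients whose denominators are bounded below by `γ`. -/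
theorem abs_div_sub_div_le {γ a b p q S : ℝ} (hγ : 0 < γ) (ha : γ ≤ a) (hb : γ ≤ b)
    (hS : |a - b| ≤ S) :
    |p / a - q / b| ≤ γ⁻¹ * |p - q| + γ⁻¹ ^ 2 * S * |q| := by
  have ha0 : 0 < a := hγ.trans_le ha
  have hb0 : 0 < b := hγ.trans_le hb
  have h : p / a - q / b = a⁻¹ * (p - q) + a⁻¹ * b⁻¹ * (b - a) * q := by
    field_simp
    ring
  have hS0 : 0 ≤ S := (abs_nonneg _).trans hS
  rw [h]
  refine (abs_add_le _ _).trans ?_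
  simp only [abs_mul, abs_inv, abs_of_pos ha0, abs_of_pos hb0, abs_sub_comm b a, sq]
  gcongr

/-- Comparison of logarithmic derivatives: if `w, v ≥ γ > 0` on `[0,1]`, then
`‖w'/w - v'/v‖_{L²} ≤ γ⁻¹ ‖w' - v'‖_{L²} + γ⁻² (sup |w - v|) ‖v'‖_{L²}`. -/
theorem log_derivative_comparison
    (γ : ℝ) (hγ : 0 < γ) (w w' v v' : ℝ → ℝ)
    (hderivw : ∀ x ∈ Set.Icc (0 : ℝ) 1, HasDerivAt w (w' x) x)
    (hderivv : ∀ x ∈ Set.Icc (0 : ℝ) 1, HasDerivAt v (v' x) x)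
    (hintw : IntervalIntegrable w' volume 0 1)
    (hintv : IntervalIntegrable v' volume 0 1)
    (hintw2 : IntervalIntegrable (fun x => (w' x) ^ 2) volume 0 1)
    (hintv2 : IntervalIntegrable (fun x => (v' x) ^ 2) volume 0 1)
    (hloww : ∀ x ∈ Set.Icc (0 : ℝ) 1, γ ≤ w x)
    (hlowv : ∀ x ∈ Set.Icc (0 : ℝ) 1, γ ≤ v x) :
    Real.sqrt (∫ x in (0:ℝ)..1, (w' x / w x - v' x / v x) ^ 2) ≤
      γ⁻¹ * Real.sqrt (∫ x in (0:ℝ)..1, (w' x - v' x) ^ 2) +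
        γ⁻¹ ^ 2 * (⨆ x : Set.Icc (0 : ℝ) 1, |w (x : ℝ) - v (x : ℝ)|) *
          Real.sqrt (∫ x in (0:ℝ)..1, (v' x) ^ 2) := by
  have hcont : ContinuousOn (fun x => |w x - v x|) (Set.Icc 0 1) := fun x hx =>
    ((hderivw x hx).continuousAt.sub (hderivv x hx).continuousAt).abs.continuousWithinAt
  have hbdd : BddAbove (Set.range fun x : Set.Icc (0 : ℝ) 1 => |w (x : ℝ) - v (x : ℝ)|) := by
    have h := isCompact_Icc.bddAbove_image hcont
    rwa [Set.image_eq_range] at h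
  set S := ⨆ x : Set.Icc (0 : ℝ) 1, |w (x : ℝ) - v (x : ℝ)|
  have hS : ∀ x ∈ Set.Icc (0 : ℝ) 1, |w x - v x| ≤ S := fun x hx => le_ciSup hbdd ⟨x, hx⟩
  have hS0 : 0 ≤ S := Real.iSup_nonneg fun _ => abs_nonneg _
  simp only [intervalIntegrable_iff_integrableOn_Ioc_of_le zero_le_one] at hintw hintv hintw2 hintv2
  simp only [integral_of_le zero_le_one]
  have hw : MemLp w' 2 (volume.restrict (Set.Ioc 0 1)) :=
    (memLp_two_iff_integrable_sq hintw.aestronglyMeasurable).2 hintw2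
  have hv : MemLp v' 2 (volume.restrict (Set.Ioc 0 1)) :=
    (memLp_two_iff_integrable_sq hintv.aestronglyMeasurable).2 hintv2
  have hf : MemLp (fun x => γ⁻¹ * |w' x - v' x|) 2 (volume.restrict (Set.Ioc 0 1)) :=
    (hw.sub hv).abs.const_mul γ⁻¹
  have hg : MemLp (fun x => γ⁻¹ ^ 2 * S * |v' x|) 2 (volume.restrict (Set.Ioc 0 1)) :=
    hv.abs.const_mul (γ⁻¹ ^ 2 * S)
  calc
    _ ≤ Real.sqrt (∫ x in Set.Ioc (0 : ℝ) 1,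
          (γ⁻¹ * |w' x - v' x| + γ⁻¹ ^ 2 * S * |v' x|) ^ 2) := by
      refine Real.sqrt_le_sqrt (integral_mono_of_nonneg (ae_of_all _ fun _ => sq_nonneg _)
        (hf.add hg).integrable_sq ?_)
      filter_upwards [ae_restrict_mem measurableSet_Ioc] with x hx
      have hx' := Set.Ioc_subset_Icc_self hx
      exact sq_le_sq.2 ((abs_div_sub_div_le hγ (hloww x hx') (hlowv x hx') (hS x hx')).trans
        (le_abs_self _))
    _ ≤ _ := sqrt_integral_add_sq_le hf hg
    _ = _ := by
      simp only [mul_pow γ⁻¹, mul_pow (γ⁻¹ ^ 2 * S), sq_abs, MeasureTheory.integral_const_mul]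
      rw [Real.sqrt_mul (by positivity), Real.sqrt_mul (by positivity),
        Real.sqrt_sq (by positivity), Real.sqrt_sq (by positivity)]
end
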